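/- For a border strip λ/μ with poset Q_{λ/μ} and reversed Schur labeling ω, the inversion and major-index q-analogues of linear extensions coincide: Σ_{σ ∈ L(Q_{λ/μ},ω)} q^{inv(σ)} = Σ_{σ ∈ L(Q_{λ/μ},ω)} q^{maj(σ)}. -/

import Mathlib

open Finset Polynomial
open scoped Classical

/-- The set of linear extensions of a finite poset `P`, i.e. order-preserving
bijections `P ≃ Fin n`. -/
noncomputable def linExts (P : Type) [Fintype P] [PartialOrder P] (n : ℕ) :
    Finset (P ≃ Fin n) :=
  Finset.univ.filter fun f => ∀ x y : P, x ≤ y → f x ≤ f y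

/-- The word of a linear extension `f` with respect to the labeling `ω`. -/
def word {P : Type} {n : ℕ} (ω : P → ℕ) (f : P ≃ Fin n) : Fin n → ℕ :=
  fun i => ω (f.symm i)

/-- The major index of a word: the sum of the (1-indexed) descent positions. -/
def majW {n : ℕ} (w : Fin n → ℕ) : ℕ :=
  ∑ i : Fin n, if h : (i : ℕ) + 1 < n then
    (if w ⟨(i : ℕ) + 1, h⟩ < w i then (i : ℕ) + 1 else 0) else 0

/-- The number of inversions of a word. -/
noncomputable def invW {n : ℕ} (w : Fin n → ℕ) : ℕ :=
  ((Finset.univ : Finset (Fin n × Fin n)).filter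
    (fun p => p.1 < p.2 ∧ w p.2 < w p.1)).card

/-- Major index `q`-analogue of the number of linear extensions of `(P, ω)`. -/
noncomputable def eMaj (P : Type) [Fintype P] [PartialOrder P] (ω : P → ℕ) :
    Polynomial ℤ :=
  ∑ f ∈ linExts P (Fintype.card P), Polynomial.X ^ majW (word ω f)

/-- Inversion `q`-analogue of the number of linear extensions of `(P, ω)`. -/
noncomputable def eInv (P : Type) [Fintype P] [PartialOrder P] (ω : P → ℕ) :
    Polynomial ℤ :=
  ∑ f ∈ linExts P (Fintype.card P), Polynomial.X ^ invW (word ω f)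

/-- Major index `q`-analogue of linear extensions whose last letter is the label
of an element of `S`. -/
noncomputable def eMajEndIn (P : Type) [Fintype P] [PartialOrder P]
    (ω : P → ℕ) (S : Set P) : Polynomial ℤ :=
  ∑ f ∈ (linExts P (Fintype.card P)).filter (fun f => ∃ s ∈ S, ∀ x, f x ≤ f s),
    Polynomial.X ^ majW (word ω f)

/-- The Gaussian binomial coefficient `[n choose k]_q`, defined by the
`q`-Pascal recurrence. -/
noncomputable def qBinom : ℕ → ℕ → Polynomial ℤ
  | _, 0 => 1
  | 0, _ + 1 => 0
  | n + 1, k + 1 => qBinom n k + Polynomial.X ^ (k + 1) * qBinom n (k + 1)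

/-- `(P,ω)`-partition. -/
def IsPPart {α : Type} [PartialOrder α] (ω : α → ℕ) (f : α → ℕ) : Prop :=
  ∀ s t : α, s ≤ t → f t ≤ f s ∧ (ω t < ω s → f t < f s)

/-- `(P,ω;s)`-partition. -/
def IsPPartS {α : Type} [PartialOrder α] (ω : α → ℕ) (s : α) (f : α → ℕ) : Prop :=
  IsPPart ω f ∧ (∀ t, f s ≤ f t) ∧ ∀ t, t ≠ s → f s = f t → ω t < ω s

/-- Generating function by size for the maps `α → ℕ` satisfying `pred`. -/
noncomputable def GPart (α : Type) [Fintype α] (pred : (α → ℕ) → Prop) :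
    PowerSeries ℚ :=
  PowerSeries.mk fun m => (Set.ncard {f : α → ℕ | pred f ∧ ∑ t, f t = m} : ℚ)
/-- A cell of the skew Young diagram `λ/μ` (1-indexed rows `1..ℓ`),
with row `i` occupying columns `μ i + 1, …, λ i`. -/
structure Cell (ℓ : ℕ) (lam mu : ℕ → ℕ) where
  row : ℕ
  col : ℕ
  row_pos : 1 ≤ row
  row_le : row ≤ ℓ
  col_gt : mu row < col
  col_le : col ≤ lam row

namespace Cell

variable {ℓ : ℕ} {lam mu : ℕ → ℕ}

theorem ext' {c d : Cell ℓ lam mu} (h1 : c.row = d.row) (h2 : c.col = d.col) :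
    c = d := by cases c; cases d; simp_all

/-- The poset order on cells, making inner corners maximal:
`(i,j) ≤ (i',j')` iff `i' ≤ i` and `j' ≤ j`. -/
instance : PartialOrder (Cell ℓ lam mu) where
  le c d := d.row ≤ c.row ∧ d.col ≤ c.col
  le_refl c := ⟨le_refl _, le_refl _⟩
  le_trans a b c hab hbc := ⟨le_trans hbc.1 hab.1, le_trans hbc.2 hab.2⟩
  le_antisymm a b hab hba :=
    ext' (le_antisymm hba.1 hab.1) (le_antisymm hba.2 hab.2)

instance : Finite (Cell ℓ lam mu) := by
  apply Finite.of_injective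
    (fun c : Cell ℓ lam mu =>
      ((⟨c.row, by have := c.row_le; omega⟩,
        ⟨c.col, by
          have h1 := c.col_le
          have h2 : lam c.row ≤ (Finset.range (ℓ + 1)).sup lam :=
            Finset.le_sup (by simp [Finset.mem_range]; have := c.row_le; omega)
          omega⟩) :
        Fin (ℓ + 1) × Fin ((Finset.range (ℓ + 1)).sup lam + 1)))
  intro c d h
  simp only [Prod.mk.injEq, Fin.mk.injEq] at h
  exact ext' h.1 h.2

noncomputable instance : Fintype (Cell ℓ lam mu) := Fintype.ofFinite _

/-- `c` comes before `d` in the traversal of the border strip from the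
bottom-left cell to the top-right cell. -/
def Earlier (c d : Cell ℓ lam mu) : Prop :=
  d.row < c.row ∨ (c.row = d.row ∧ c.col < d.col)

/-- `ω` is a reversed Schur labeling of the cells: labels decrease along the
traversal from bottom-left to top-right (equivalently, labels increase from
right to left along rows and from top to bottom along columns). -/
def IsRevSchur (ω : Cell ℓ lam mu → ℕ) : Prop :=
  ∀ c d : Cell ℓ lam mu, Earlier c d → ω d < ω c

/-- `u` is an inner corner of the border strip: a maximal cell of the poset. -/
def IsInnerCorner (u : Cell ℓ lam mu) : Prop :=
  ∀ c : Cell ℓ lam mu, u ≤ c → c = u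

end Cell

/-- `λ/μ` (rows `1..ℓ`, all nonempty) is a connected border strip: consecutive
rows overlap in exactly one column. -/
def IsBorderStrip (ℓ : ℕ) (lam mu : ℕ → ℕ) : Prop :=
  (∀ i, 1 ≤ i → i ≤ ℓ → mu i < lam i) ∧
    (∀ i, 1 ≤ i → i < ℓ → mu i + 1 = lam (i + 1))

/-! ### Foata's second fundamental transformation on lists with a key function -/

/-- Cut a list into blocks ending at letters satisfying `p`, and rotate every block so that its
last letter comes first. -/
def foataRot {α : Type} (p : α → Bool) : List α → List α
  | [] => []
  | x :: v => if p x then x :: foataRot p v else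
      match foataRot p v with
      | [] => [x]
      | y :: r => y :: x :: r

/-- The block-ending predicate: `b = true` for letters `≤ a`, `b = false` for letters `> a`. -/
def foataPred {α : Type} (k : α → ℕ) (a : α) (b : Bool) (y : α) : Bool :=
  decide (k y ≤ k a) == b

/-- Is the head of the (reversed) word at most `a`? -/
def foataDir {α : Type} (k : α → ℕ) (a : α) : List α → Bool
  | [] => true
  | y :: _ => decide (k y ≤ k a)

/-- Foata's map; the input is the reversed word, the output is a word. -/
def foata {α : Type} (k : α → ℕ) : List α → List α
  | [] => []
  | a :: w => foataRot (foataPred k a (foataDir k a w)) (foata k w) ++ [a]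

/-- Inversions of a list. -/
def invL {α : Type} (k : α → ℕ) : List α → ℕ
  | [] => 0
  | x :: v => v.countP (fun y => decide (k y < k x)) + invL k v

/-- Major index of a reversed word. -/
def majL {α : Type} (k : α → ℕ) : List α → ℕ
  | [] => 0
  | a :: w => (if foataDir k a w then 0 else w.length) + majL k w

theorem foataRot_perm {α : Type} (p : α → Bool) (l : List α) : (foataRot p l).Perm l := by
  induction l with
  | nil => simp [foataRot]
  | cons x v ih =>
    unfold foataRot
    split_ifs with h
    · exact ih.cons x
    · split
      · next h2 => rw [h2] at ih; simpa using ih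
      · next y r h2 =>
        rw [h2] at ih
        exact (List.Perm.swap x y r).trans (ih.cons x)

/-- The last letter (if any) satisfies `p`. -/
def LastSat {α : Type} (p : α → Bool) (l : List α) : Prop := ∀ x ∈ l.getLast?, p x = true

theorem LastSat.tail {α : Type} {p : α → Bool} {x : α} {v : List α} (h : LastSat p (x :: v)) :
    LastSat p v := by
  cases v with
  | nil => simp [LastSat]
  | cons y r => simpa [LastSat] using h

theorem LastSat.ne_nil {α : Type} {p : α → Bool} {x : α} {v : List α} (h : LastSat p (x :: v))
    (hx : ¬ p x = true) : v ≠ [] := by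
  rintro rfl
  simp [LastSat] at h
  exact hx h

theorem foataRot_head {α : Type} (p : α → Bool) (l : List α) (h : LastSat p l) :
    ∀ y ∈ (foataRot p l).head?, p y = true := by
  induction l with
  | nil => simp [foataRot]
  | cons x v ih =>
    unfold foataRot
    split_ifs with hx
    · simpa using hx
    · split
      · next h2 =>
        have := foataRot_perm p v
        rw [h2] at this
        exact absurd (List.nil_perm.1 this) (h.ne_nil hx)
      · next y r h2 =>
        have := ih h.tail
        rw [h2] at this
        simpa using this

theorem foataRot_shape {α : Type} (p : α → Bool) (x : α) (v : List α) (h : LastSat p (x :: v))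
    (hx : ¬ p x = true) :
    ∃ y r, p y = true ∧ foataRot p v = y :: r ∧ foataRot p (x :: v) = y :: x :: r := by
  have hne := h.ne_nil hx
  have hh := foataRot_head p v h.tail
  have hp := foataRot_perm p v
  cases h2 : foataRot p v with
  | nil => rw [h2] at hp; exact absurd (List.nil_perm.1 hp) hne
  | cons y r =>
    rw [h2] at hh
    refine ⟨y, r, by simpa using hh, rfl, ?_⟩
    simp [foataRot, hx, h2]

theorem foataRot_inj {α : Type} (p : α → Bool) (l m : List α) (hl : LastSat p l)
    (hm : LastSat p m) (h : foataRot p l = foataRot p m) : l = m := by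
  induction l generalizing m with
  | nil =>
    have := foataRot_perm p m
    rw [← h] at this
    exact (List.nil_perm.1 (by simpa [foataRot] using this)).symm
  | cons x v ih =>
    cases m with
    | nil =>
      have := foataRot_perm p (x :: v)
      rw [h] at this
      exact (List.nil_perm.1 (by simpa [foataRot] using this))
    | cons x' v' =>
      have hv := foataRot_head p v hl.tail
      have hv' := foataRot_head p v' hm.tail
      by_cases hx : p x = true <;> by_cases hx' : p x' = true
      · simp only [foataRot, hx, hx', if_true, List.cons.injEq] at h
        rw [h.1, ih v' hl.tail hm.tail h.2]
      · obtain ⟨y, r, hy, h1, h2⟩ := foataRot_shape p x' v' hm hx'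
        rw [h2] at h
        simp only [foataRot, hx, if_true, List.cons.injEq] at h
        rw [h.2] at hv
        simp at hv
        exact absurd hv hx'
      · obtain ⟨y, r, hy, h1, h2⟩ := foataRot_shape p x v hl hx
        rw [h2] at h
        simp only [foataRot, hx', if_true, List.cons.injEq] at h
        rw [← h.2] at hv'
        simp at hv'
        exact absurd hv' hx
      · obtain ⟨y, r, hy, h1, h2⟩ := foataRot_shape p x v hl hx
        obtain ⟨y', r', hy', h1', h2'⟩ := foataRot_shape p x' v' hm hx'
        rw [h2, h2'] at h
        simp only [List.cons.injEq] at h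
        obtain ⟨e1, e2, e3⟩ := h
        rw [e2, ih v' hl.tail hm.tail (by rw [h1, h1', e1, e3])]

theorem foataRot_filter {α : Type} (p q : α → Bool) (l : List α) (hl : LastSat p l)
    (hq : (∀ x, q x = p x) ∨ (∀ x, q x = !p x)) :
    (foataRot p l).filter q = l.filter q := by
  induction l with
  | nil => simp [foataRot]
  | cons x v ih =>
    have ih := ih hl.tail
    by_cases hx : p x = true
    · simp [foataRot, hx, List.filter_cons, ih]
    · obtain ⟨y, r, hy, h1, h2⟩ := foataRot_shape p x v hl hx
      rw [h1] at ih
      rw [h2]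
      rw [List.filter_cons (xs := v), ← ih]
      rcases hq with hq | hq <;> simp [List.filter_cons, hq, hy, hx]

theorem foataRot_inv_le {α : Type} (k : α → ℕ) (a : α) (l : List α)
    (hl : LastSat (foataPred k a true) l) :
    invL k (foataRot (foataPred k a true) l) + l.countP (fun y => decide (k a < k y))
      = invL k l := by
  induction l with
  | nil => simp [foataRot, invL]
  | cons x v ih =>
    have ih := ih hl.tail
    have hp := foataRot_perm (foataPred k a true) v
    by_cases hx : foataPred k a true x = true
    · have hx2 : ¬ k a < k x := by simpa [foataPred] using hx
      simp only [foataRot, hx, if_true, invL, List.countP_cons, hx2, hp.countP_eq]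
      simp
      omega
    · obtain ⟨y, r, hy, h1, h2⟩ := foataRot_shape _ x v hl hx
      have hx2 : k a < k x := by simpa [foataPred] using hx
      have hy2 : k y ≤ k a := by simpa [foataPred] using hy
      rw [h1] at ih hp
      rw [h2]
      simp only [invL, ← hp.countP_eq, List.countP_cons] at ih ⊢
      have e1 : k y < k x := by omega
      have e2 : ¬ k x < k y := by omega
      simp [e1, e2, hx2, hy2] at ih ⊢
      omega

theorem foataRot_inv_gt {α : Type} (k : α → ℕ) (a : α) (l : List α)
    (hl : LastSat (foataPred k a false) l) :
    invL k (foataRot (foataPred k a false) l)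
      = invL k l + l.countP (fun y => decide (k y ≤ k a)) := by
  induction l with
  | nil => simp [foataRot, invL]
  | cons x v ih =>
    have ih := ih hl.tail
    have hp := foataRot_perm (foataPred k a false) v
    by_cases hx : foataPred k a false x = true
    · have hx2 : ¬ k x ≤ k a := by simpa [foataPred] using hx
      simp only [foataRot, hx, if_true, invL, List.countP_cons, hx2, hp.countP_eq]
      simp
      omega
    · obtain ⟨y, r, hy, h1, h2⟩ := foataRot_shape _ x v hl hx
      have hx2 : k x ≤ k a := by simpa [foataPred] using hx
      have hy2 : ¬ k y ≤ k a := by simpa [foataPred] using hy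
      rw [h1] at ih hp
      rw [h2]
      simp only [invL, ← hp.countP_eq, List.countP_cons] at ih ⊢
      have e1 : ¬ k y < k x := by omega
      have e2 : k x < k y := by omega
      simp [e1, e2, hx2, hy2] at ih ⊢
      omega

theorem foata_perm {α : Type} (k : α → ℕ) (w : List α) : (foata k w).Perm w := by
  induction w with
  | nil => simp [foata]
  | cons a w ih =>
    unfold foata
    exact List.perm_append_comm.trans (((foataRot_perm _ _).trans ih).cons a)

theorem foata_last {α : Type} (k : α → ℕ) (a : α) (w : List α) :
    LastSat (foataPred k a (foataDir k a w)) (foata k w) := by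
  cases w with
  | nil => simp [LastSat, foata]
  | cons y w => simp [LastSat, foata, foataPred, foataDir]

theorem foata_inj {α : Type} (k : α → ℕ) (w w' : List α) (h : foata k w = foata k w') :
    w = w' := by
  induction w generalizing w' with
  | nil =>
    have := foata_perm k w'
    rw [← h] at this
    exact (List.nil_perm.1 (by simpa [foata] using this)).symm
  | cons a w ih =>
    cases w' with
    | nil =>
      have := foata_perm k (a :: w)
      rw [h] at this
      exact (List.nil_perm.1 (by simpa [foata] using this))
    | cons a' w' =>
      simp only [foata] at h
      obtain ⟨h1, h2⟩ := List.append_inj' h rfl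
      obtain rfl : a = a' := by simpa using h2
      have hl := foata_last k a w
      have hl' := foata_last k a w'
      have hd : w ≠ [] → foataDir k a w = foataDir k a w' := by
        intro hw
        have g1 := foataRot_head _ _ hl
        have g2 := foataRot_head _ _ hl'
        rw [← h1] at g2
        cases hR : foataRot (foataPred k a (foataDir k a w)) (foata k w) with
        | nil =>
          have := (foataRot_perm (foataPred k a (foataDir k a w)) (foata k w)).trans
            (foata_perm k w)
          rw [hR] at this
          exact absurd (List.nil_perm.1 this) hw
        | cons y r =>
          rw [hR] at g1 g2
          simp [foataPred] at g1 g2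
          rw [← g1, ← g2]
      by_cases hw : w = []
      · subst hw
        have := (foataRot_perm (foataPred k a (foataDir k a w')) (foata k w')).trans
            (foata_perm k w')
        rw [← h1] at this
        have hw' : w' = [] := List.nil_perm.1 (by simpa [foata, foataRot] using this)
        rw [hw']
      · rw [← hd hw] at h1 hl'
        rw [ih w' (foataRot_inj _ _ _ hl hl' h1)]

theorem invL_snoc {α : Type} (k : α → ℕ) (l : List α) (a : α) :
    invL k (l ++ [a]) = invL k l + l.countP (fun y => decide (k a < k y)) := by
  induction l with
  | nil => simp [invL]
  | cons x v ih =>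
    simp only [List.cons_append, invL, ih, List.countP_append, List.countP_cons, List.countP_nil]
    omega

theorem foata_inv {α : Type} (k : α → ℕ) (w : List α) : invL k (foata k w) = majL k w := by
  induction w with
  | nil => simp [foata, invL, majL]
  | cons a w ih =>
    simp only [foata, majL, invL_snoc]
    have hl := foata_last k a w
    have hp := foata_perm k w
    cases hd : foataDir k a w with
    | true =>
      rw [hd] at hl
      have := foataRot_inv_le k a _ hl
      rw [(foataRot_perm _ _).countP_eq, this, ih]
      simp
    | false =>
      rw [hd] at hl
      have := foataRot_inv_gt k a _ hl
      rw [(foataRot_perm _ _).countP_eq, this, ih]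
      have h2 := List.length_eq_countP_add_countP (fun y => decide (k y ≤ k a)) (l := foata k w)
      rw [hp.length_eq] at h2
      simp at h2 ⊢
      omega

theorem foata_order {α : Type} (k : α → ℕ) (hk : Function.Injective k) (a b : α)
    (hab : ∀ c, ¬ (k a < k c ∧ k c < k b) ∧ ¬ (k b < k c ∧ k c < k a))
    (w : List α) (hw : w.Nodup) (h : [a, b].Sublist w.reverse) : [a, b].Sublist (foata k w) := by
  induction w with
  | nil => simpa using h
  | cons c w ih =>
    rw [List.nodup_cons] at hw
    rw [List.reverse_cons] at h
    simp only [foata]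
    set p := foataPred k c (foataDir k c w) with hpdef
    have hp : (foataRot p (foata k w)).Perm w := (foataRot_perm _ _).trans (foata_perm k w)
    have hsplit : [a, b].Sublist w.reverse ∨ (a ∈ w ∧ b = c) := by
      rw [List.sublist_append_iff] at h
      obtain ⟨l1, l2, e, s1, s2⟩ := h
      have := s2.length_le
      match l2, this with
      | [], _ => left; simpa [e] using s1
      | [d], _ =>
        right
        have hd : d = c := by simpa using s2
        match l1, e with
        | [x], e =>
          simp at e
          have := s1.subset (List.mem_singleton_self x)
          simp at this
          exact ⟨e.1 ▸ this, e.2.trans hd⟩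
        | [], e => simp at e
        | _ :: _ :: _, e => simp at e
      | _ :: _ :: _, h => simp at h
    rcases hsplit with h | ⟨h1, rfl⟩
    · have ha : a ∈ w := by have := h.subset (a := a) (by simp); simpa using this
      have hb : b ∈ w := by have := h.subset (a := b) (by simp); simpa using this
      have hca : k c ≠ k a := fun e => hw.1 (hk e ▸ ha)
      have hcb : k c ≠ k b := fun e => hw.1 (hk e ▸ hb)
      have hc := hab c
      have hpab : p a = p b := by
        have : decide (k a ≤ k c) = decide (k b ≤ k c) := by
          rw [decide_eq_decide]; omega
        simp [hpdef, foataPred, this]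
      have hs := ih hw.2 h
      refine List.Sublist.trans ?_ (List.sublist_append_left _ _)
      have key : ∀ q : α → Bool, ((∀ x, q x = p x) ∨ (∀ x, q x = !p x)) → q a = true →
          q b = true → [a, b].Sublist (foataRot p (foata k w)) := by
        intro q hq qa qb
        have e : [a, b] = [a, b].filter q := by simp [qa, qb]
        rw [e]
        refine (hs.filter q).trans ?_
        rw [← foataRot_filter p q _ (foata_last k c w) hq]
        exact List.filter_sublist
      cases hpa : p a with
      | true => exact key p (Or.inl fun _ => rfl) hpa (hpab ▸ hpa)
      | false =>
        exact key (fun x => !p x) (Or.inr fun _ => rfl) (by simp [hpa]) (by simp [← hpab, hpa])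
    · have : a ∈ foataRot p (foata k w) := hp.mem_iff.2 h1
      exact (List.singleton_sublist.2 this).append (List.Sublist.refl [b])

theorem pair_sublist {α : Type} (x y : α) (hxy : x ≠ y) (l : List α) (hx : x ∈ l) (hy : y ∈ l) :
    [x, y].Sublist l ∨ [y, x].Sublist l := by
  induction l with
  | nil => simp at hx
  | cons z l ih =>
    rcases List.mem_cons.1 hx with rfl | hx'
    · rcases List.mem_cons.1 hy with rfl | hy'
      · exact absurd rfl hxy
      · left; exact (List.singleton_sublist.2 hy').cons_cons _
    · rcases List.mem_cons.1 hy with rfl | hy'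
      · right; exact (List.singleton_sublist.2 hx').cons_cons _
      · exact (ih hx' hy').imp (fun h => h.cons _) (fun h => h.cons _)

/-! ### Transfer between words `Fin n → ℕ` and lists -/

theorem countP_ofFn_sum {α : Type} {n : ℕ} (g : Fin n → α) (p : α → Bool) :
    (List.ofFn g).countP p = ∑ i, if p (g i) then 1 else 0 := by
  induction n with
  | zero => simp
  | succ n ih =>
    rw [List.ofFn_succ, List.countP_cons, ih, Fin.sum_univ_succ]
    omega

theorem invW_eq_invL {α : Type} (k : α → ℕ) {n : ℕ} (g : Fin n → α) :
    invW (fun i => k (g i)) = invL k (List.ofFn g) := by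
  have hsum : ∀ {n : ℕ} (g : Fin n → α), invW (fun i => k (g i)) =
      ∑ i : Fin n, ∑ j : Fin n, if i < j ∧ k (g j) < k (g i) then 1 else 0 := by
    intro n g
    rw [invW, Finset.card_filter, ← Finset.univ_product_univ, Finset.sum_product]
  induction n with
  | zero => simp [invW, invL]
  | succ n ih =>
    rw [hsum, List.ofFn_succ, invL, ← ih, hsum, Fin.sum_univ_succ, countP_ofFn_sum]
    congr 1
    · rw [Fin.sum_univ_succ]; simp
    · refine Finset.sum_congr rfl fun i _ => ?_
      rw [Fin.sum_univ_succ]; simp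

theorem majW_eq_majL {α : Type} (k : α → ℕ) {n : ℕ} (g : Fin n → α) :
    majW (fun i => k (g i)) = majL k (List.ofFn g).reverse := by
  induction n with
  | zero => simp [majW, majL]
  | succ n ih =>
    rw [List.ofFn_succ', List.concat_eq_append, List.reverse_append]
    simp only [List.reverse_cons, List.reverse_nil, List.nil_append, List.cons_append, majL]
    rw [← ih]
    cases n with
    | zero => simp [majW, foataDir]
    | succ m =>
      rw [List.ofFn_succ', List.concat_eq_append, List.reverse_append]
      simp only [List.reverse_cons, List.reverse_nil, List.nil_append, List.cons_append, foataDir]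
      simp only [majW]
      rw [Fin.sum_univ_castSucc, Fin.sum_univ_castSucc, Fin.sum_univ_castSucc (n := m)]
      simp
      have e2 : (⟨m+1, by omega⟩ : Fin (m+1+1)) = Fin.last (m+1) := rfl
      by_cases hh : k (g (Fin.last (m+1))) < k (g (Fin.last m).castSucc)
      · have : ¬ k (g (Fin.last m).castSucc) ≤ k (g (Fin.last (m+1))) := by omega
        simp [hh, this, e2]
        rw [add_comm]
      · have : k (g (Fin.last m).castSucc) ≤ k (g (Fin.last (m+1))) := by omega
        simp [hh, this, e2]

/-! ### The border strip -/

theorem strip_mono {ℓ : ℕ} {lam mu : ℕ → ℕ} (hbs : IsBorderStrip ℓ lam mu) (i j : ℕ) (hi : 1 ≤ i)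
    (hij : i < j) (hj : j ≤ ℓ) : lam j ≤ mu i + 1 := by
  induction j, hij using Nat.le_induction with
  | base => exact (hbs.2 i hi (by omega)).ge
  | succ j hij ih =>
    have h1 := ih (by omega)
    have h2 := hbs.2 j (by omega) (by omega)
    have h3 := hbs.1 j (by omega) (by omega)
    omega

theorem strip_between {ℓ : ℕ} {lam mu : ℕ → ℕ} (hbs : IsBorderStrip ℓ lam mu)
    (ω : Cell ℓ lam mu → ℕ) (hω : Cell.IsRevSchur ω) (x y z : Cell ℓ lam mu) (hxy : x ≤ y)
    (hz : (ω x < ω z ∧ ω z < ω y) ∨ (ω y < ω z ∧ ω z < ω x)) : x ≤ z ∧ z ≤ y := by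
  obtain ⟨hr, hc⟩ : y.row ≤ x.row ∧ y.col ≤ x.col := hxy
  show (z.row ≤ x.row ∧ z.col ≤ x.col) ∧ (y.row ≤ z.row ∧ y.col ≤ z.col)
  have lt : ∀ c d : Cell ℓ lam mu, ω d < ω c →
      d.row < c.row ∨ (c.row = d.row ∧ c.col < d.col) := by
    intro c d h
    by_contra hcon
    by_cases heq : c = d
    · subst heq; omega
    · have : Cell.Earlier d c := by
        unfold Cell.Earlier
        by_contra h2
        exact heq (Cell.ext' (by omega) (by omega))
      have := hω _ _ this
      omega
  have mono : ∀ c d : Cell ℓ lam mu, d.row < c.row → c.col ≤ d.col := by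
    intro c d h
    have := strip_mono hbs d.row c.row d.row_pos h c.row_le
    have := c.col_le
    have := d.col_gt
    omega
  have m1 := mono x y
  have m2 := mono x z
  have m3 := mono z y
  have m4 := mono y z
  have m5 := mono z x
  rcases hz with ⟨h1, h2⟩ | ⟨h1, h2⟩
  · have := lt _ _ h1
    have := lt _ _ h2
    omega
  · have := lt _ _ h1
    have := lt _ _ h2
    omega

theorem exists_equiv_of_list {P : Type} [Fintype P] (l : List P) (hn : l.Nodup)
    (hm : ∀ x, x ∈ l) : ∃ g : P ≃ Fin (Fintype.card P), List.ofFn g.symm = l := by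
  have hlen : l.length = Fintype.card P := by
    rw [← List.toFinset_card_of_nodup hn, ← Finset.card_univ]
    congr 1
    ext x
    simp [hm x]
  generalize Fintype.card P = n at hlen
  subst hlen
  refine ⟨(List.Nodup.getEquivOfForallMemList l hn hm).symm, ?_⟩
  simp only [Equiv.symm_symm]
  exact List.ofFn_get l

theorem foata_equiv {P : Type} [Fintype P] (ω : P → ℕ) (f : P ≃ Fin (Fintype.card P)) :
    ∃ g : P ≃ Fin (Fintype.card P),
      List.ofFn g.symm = foata ω (List.ofFn f.symm).reverse := by
  have hp := (foata_perm ω (List.ofFn f.symm).reverse).trans (List.reverse_perm _)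
  apply exists_equiv_of_list
  · exact hp.nodup_iff.2 (List.nodup_ofFn.2 f.symm.injective)
  · intro x
    rw [hp.mem_iff, List.mem_ofFn]
    exact ⟨f x, by simp⟩

theorem lt_of_sublist {P : Type} {n : ℕ} (f : P ≃ Fin n) (x y : P)
    (h : [x, y].Sublist (List.ofFn f.symm)) : f x < f y := by
  have hpw : (List.ofFn f.symm).Pairwise (fun a b => f a < f b) := by
    rw [List.pairwise_ofFn]
    intro i j hij
    simpa using hij
  simpa using hpw.sublist h

theorem sublist_of_lt {P : Type} {n : ℕ} (f : P ≃ Fin n) (x y : P) (h : f x < f y) :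
    [x, y].Sublist (List.ofFn f.symm) := by
  have hm : ∀ z, z ∈ List.ofFn f.symm := fun z => by
    rw [List.mem_ofFn]; exact ⟨f z, by simp⟩
  rcases pair_sublist x y (by rintro rfl; exact lt_irrefl _ h) _ (hm x) (hm y) with h1 | h1
  · exact h1
  · exact absurd (lt_of_sublist f y x h1) (lt_asymm h)

theorem foata_linExt {ℓ : ℕ} {lam mu : ℕ → ℕ} (hbs : IsBorderStrip ℓ lam mu)
    (ω : Cell ℓ lam mu → ℕ) (hinj : Function.Injective ω) (hω : Cell.IsRevSchur ω) {n : ℕ}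
    (f g : Cell ℓ lam mu ≃ Fin n)
    (hg : List.ofFn g.symm = foata ω (List.ofFn f.symm).reverse)
    (hf : ∀ x y, x ≤ y → f x ≤ f y) : ∀ x y, x ≤ y → g x ≤ g y := by
  have main : ∀ N : ℕ, ∀ x y : Cell ℓ lam mu, (ω x - ω y) + (ω y - ω x) ≤ N → x ≤ y →
      g x ≤ g y := by
    intro N
    induction N with
    | zero =>
      intro x y hN _
      rw [hinj (show ω x = ω y by omega)]
    | succ N ih =>
      intro x y hN hxy
      by_cases hz : ∃ z, (ω x < ω z ∧ ω z < ω y) ∨ (ω y < ω z ∧ ω z < ω x)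
      · obtain ⟨z, hz⟩ := hz
        obtain ⟨h1, h2⟩ := strip_between hbs ω hω x y z hxy hz
        exact (ih x z (by omega) h1).trans (ih z y (by omega) h2)
      · by_cases he : x = y
        · rw [he]
        · have hlt : f x < f y := lt_of_le_of_ne (hf x y hxy) (fun e => he (f.injective e))
          apply le_of_lt
          apply lt_of_sublist
          rw [hg]
          refine foata_order ω hinj x y ?_ _ ?_ ?_
          · intro c
            constructor
            · exact fun h => hz ⟨c, Or.inl h⟩
            · exact fun h => hz ⟨c, Or.inr h⟩
          · exact List.nodup_reverse.2 (List.nodup_ofFn.2 f.symm.injective)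
          · rw [List.reverse_reverse]
            exact sublist_of_lt f x y hlt
  exact fun x y h => main _ x y le_rfl h

/-- For a border strip `λ/μ` with reversed Schur labeling, the inversion and
major-index `q`-analogues of linear extensions coincide. -/
theorem eInv_eq_eMaj_border_strip (ℓ : ℕ) (lam mu : ℕ → ℕ)
    (hbs : IsBorderStrip ℓ lam mu) (ω : Cell ℓ lam mu → ℕ)
    (hinj : Function.Injective ω) (hω : Cell.IsRevSchur ω) :
    eInv (Cell ℓ lam mu) ω = eMaj (Cell ℓ lam mu) ω := by
  choose Φ hΦ using fun f : Cell ℓ lam mu ≃ Fin (Fintype.card (Cell ℓ lam mu)) => foata_equiv ω f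
  have hmem : ∀ f ∈ linExts (Cell ℓ lam mu) (Fintype.card (Cell ℓ lam mu)),
      Φ f ∈ linExts (Cell ℓ lam mu) (Fintype.card (Cell ℓ lam mu)) := by
    intro f hf
    simp only [linExts, Finset.mem_filter, Finset.mem_univ, true_and] at hf ⊢
    exact foata_linExt hbs ω hinj hω f (Φ f) (hΦ f) hf
  have hΦinj : Function.Injective Φ := by
    intro f f' h
    have h1 := hΦ f
    rw [h, hΦ f'] at h1
    have h2 := List.reverse_injective (foata_inj ω _ _ h1)
    have h3 := List.ofFn_injective h2
    have h4 : f.symm = f'.symm := Equiv.coe_fn_injective h3.symm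
    rw [← Equiv.symm_symm f, h4, Equiv.symm_symm]
  have himg : (linExts (Cell ℓ lam mu) (Fintype.card (Cell ℓ lam mu))).image Φ =
      linExts (Cell ℓ lam mu) (Fintype.card (Cell ℓ lam mu)) := by
    apply Finset.eq_of_subset_of_card_le
    · intro g hg
      obtain ⟨f, hf, rfl⟩ := Finset.mem_image.1 hg
      exact hmem f hf
    · rw [Finset.card_image_of_injective _ hΦinj]
  unfold eInv eMaj
  rw [← himg, Finset.sum_image (fun _ _ _ _ h => hΦinj h), himg]
  refine Finset.sum_congr rfl fun f _ => ?_
  congr 1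
  unfold word
  rw [invW_eq_invL ω (Φ f).symm, majW_eq_majL ω f.symm, hΦ f, foata_inv]
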